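/- Assume ‖𝓗̂ − 𝓗‖_op / γ_J < 1/4, and let Ψ̂_J := (⟨ψ_k, ψ̂_ℓ⟩)_{k,ℓ∈J} ∈ ℝ^{|J|×|J|}. Then ‖ Ψ̂_J · diag(λ̂_k)_{k∈J} · Ψ̂_Jᵀ − diag(λ_k)_{k∈J} − (⟨(𝓗̂−𝓗)ψ_k, ψ_ℓ⟩)_{k,ℓ∈J} ‖_op ≤ 4K·(γ_J + 2·θ_max)·(‖𝓗̂−𝓗‖_op / γ_J)². -/

import Mathlib

open scoped InnerProductSpace
open Filter

noncomputable section

/-- The rank-one operator `u ⊗ v : w ↦ ⟨v, w⟩ u` on a real inner product space. -/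
def rankOne {H : Type*} [NormedAddCommGroup H] [InnerProductSpace ℝ H] (u v : H) :
    H →L[ℝ] H :=
  (innerSL ℝ v).smulRight u

/-- Operator (spectral) norm of a real matrix w.r.t. Euclidean norms. -/
def matOpNorm {m : ℕ} (M : Matrix (Fin m) (Fin m) ℝ) : ℝ :=
  ‖(Matrix.toEuclideanCLM (𝕜 := ℝ) M : EuclideanSpace ℝ (Fin m) →L[ℝ] EuclideanSpace ℝ (Fin m))‖


section helpers
variable {H : Type*} [NormedAddCommGroup H] [InnerProductSpace ℝ H]

lemma aux_apply {A : H →L[ℝ] H} {lam : ℕ → ℝ} {psi : ℕ → H}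
    (hsum : HasSum (fun k => lam k • rankOne (psi k) (psi k)) A) (v : H) :
    HasSum (fun k => (lam k * ⟪psi k, v⟫_ℝ) • psi k) (A v) := by
  have h := (ContinuousLinearMap.apply ℝ H v).hasSum hsum
  simpa [rankOne, Function.comp_def, smul_smul] using h

lemma aux_inner {A : H →L[ℝ] H} {lam : ℕ → ℝ} {psi : ℕ → H}
    (hsum : HasSum (fun k => lam k • rankOne (psi k) (psi k)) A) (v w : H) :
    HasSum (fun k => lam k * ⟪psi k, v⟫_ℝ * ⟪psi k, w⟫_ℝ) ⟪A v, w⟫_ℝ := by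
  have h := (innerSL ℝ w).hasSum (aux_apply hsum v)
  simp only [innerSL_apply_apply, Function.comp_def, inner_smul_right] at h
  rw [real_inner_comm]
  simpa only [real_inner_comm] using h

lemma aux_eig {A : H →L[ℝ] H} {lam : ℕ → ℝ} {psi : ℕ → H} (hpsi : Orthonormal ℝ psi)
    (hsum : HasSum (fun k => lam k • rankOne (psi k) (psi k)) A) (i : ℕ) :
    A (psi i) = lam i • psi i := by
  have h := aux_apply hsum (psi i)
  refine h.unique ?_
  have h2 := hasSum_single (f := fun k => (lam k * ⟪psi k, psi i⟫_ℝ) • psi k) i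
    (fun k hk => by simp [hpsi.2 hk])
  simpa [hpsi.1 i] using h2

lemma aux_weyl {A B : H →L[ℝ] H} {lam mu : ℕ → ℝ} {psi phi : ℕ → H}
    (hpsi : Orthonormal ℝ psi) (hphi : Orthonormal ℝ phi)
    (hlam : Antitone lam) (hmu : Antitone mu) (hnn : ∀ k, 0 ≤ lam k) (hnn' : ∀ k, 0 ≤ mu k)
    (hA : HasSum (fun k => lam k • rankOne (psi k) (psi k)) A)
    (hB : HasSum (fun k => mu k • rankOne (phi k) (phi k)) B) (k : ℕ) :
    mu k ≤ lam k + ‖B - A‖ := by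
  let F : (Fin (k+1) → ℝ) →ₗ[ℝ] (Fin k → ℝ) :=
    LinearMap.pi fun i => ∑ a : Fin (k+1), ⟪psi i, phi a⟫_ℝ • LinearMap.proj a
  have hF : LinearMap.ker F ≠ ⊥ := F.ker_ne_bot_of_finrank_lt (by simp)
  obtain ⟨c, hc, hc0⟩ := (Submodule.ne_bot_iff _).1 hF
  set v : H := ∑ a : Fin (k+1), c a • phi a with hv
  have hphi' : Orthonormal ℝ (fun a : Fin (k+1) => phi a) := hphi.comp _ Fin.val_injective
  have hvn : ⟪v, v⟫_ℝ = ∑ a, c a * c a := by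
    have := hphi'.inner_sum c c Finset.univ
    simpa using this
  have hpos : 0 < ∑ a, c a * c a := by
    obtain ⟨a, ha⟩ := Function.ne_iff.1 hc0
    exact Finset.sum_pos' (fun i _ => mul_self_nonneg _) ⟨a, Finset.mem_univ _, by
      have : c a ≠ 0 := ha
      exact mul_self_pos.2 this⟩
  have horth : ∀ i, i < k → ⟪psi i, v⟫_ℝ = 0 := by
    intro i hi
    have := congrFun (LinearMap.mem_ker.1 hc) ⟨i, hi⟩
    simp [F] at this
    rw [hv, inner_sum, ← this]
    refine Finset.sum_congr rfl fun a _ => ?_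
    rw [inner_smul_right, mul_comm]
  have h1 : ⟪A v, v⟫_ℝ ≤ lam k * ⟪v, v⟫_ℝ := by
    refine hasSum_le_of_sum_le (aux_inner hA v v) fun s => ?_
    calc ∑ i ∈ s, lam i * ⟪psi i, v⟫_ℝ * ⟪psi i, v⟫_ℝ
        ≤ ∑ i ∈ s, lam k * ‖⟪psi i, v⟫_ℝ‖ ^ 2 := by
          refine Finset.sum_le_sum fun i _ => ?_
          rw [Real.norm_eq_abs, sq_abs, mul_assoc, ← sq]
          rcases lt_or_ge i k with h | h
          · simp [horth i h]
          · exact mul_le_mul_of_nonneg_right (hlam h) (sq_nonneg _)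
      _ ≤ lam k * ⟪v, v⟫_ℝ := by
          rw [← Finset.mul_sum, real_inner_self_eq_norm_sq]
          exact mul_le_mul_of_nonneg_left (hpsi.sum_inner_products_le v) (hnn k)
  have h2 : mu k * ⟪v, v⟫_ℝ ≤ ⟪B v, v⟫_ℝ := by
    have hBv : B v = ∑ a : Fin (k+1), (mu a * c a) • phi a := by
      rw [hv, map_sum]
      refine Finset.sum_congr rfl fun a _ => ?_
      rw [map_smul, aux_eig hphi hB, smul_smul, mul_comm]
    have := hphi'.inner_sum (fun a => mu a * c a) c Finset.univ
    rw [hBv, hvn, this, Finset.mul_sum]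
    refine Finset.sum_le_sum fun a _ => ?_
    simp only [conj_trivial]
    rw [mul_assoc]
    exact mul_le_mul_of_nonneg_right (hmu (by omega)) (mul_self_nonneg _)
  have h3 : ⟪(B - A) v, v⟫_ℝ ≤ ‖B - A‖ * ⟪v, v⟫_ℝ := by
    refine (real_inner_le_norm _ _).trans ?_
    rw [real_inner_self_eq_norm_sq, sq, ← mul_assoc]
    exact mul_le_mul_of_nonneg_right ((B - A).le_opNorm v) (norm_nonneg _)
  rw [ContinuousLinearMap.sub_apply, inner_sub_left] at h3
  rw [hvn] at h1 h2 h3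
  refine le_of_mul_le_mul_right ?_ hpos
  rw [add_mul]
  linarith

lemma aux_scalar {γ t th d l : ℝ} (hγ : 0 < γ) (ht : th ≤ t) (hth : 0 ≤ th)
    (hd : 3 / 4 * γ ≤ |l - th|) (hdd : d = 4 * (γ + 2 * t) / γ ^ 2) :
    l ≤ d * (l - th) ^ 2 := by
  rw [← sq_abs]
  have hl : l ≤ th + |l - th| := by linarith [le_abs_self (l - th)]
  refine hl.trans ?_
  set x := |l - th|
  rw [hdd, div_mul_eq_mul_div, le_div_iff₀ (by positivity)]
  have hx : 0 ≤ x := by positivity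
  have h1 : γ ^ 2 ≤ 2 * x ^ 2 := by nlinarith
  have h2 : γ ≤ 2 * x := by linarith
  have h3 : th * γ ^ 2 ≤ t * (2 * x ^ 2) :=
    mul_le_mul ht h1 (by positivity) (by linarith)
  have h4 : x * γ * γ ≤ x * γ * (2 * x) := mul_le_mul_of_nonneg_left h2 (by positivity)
  have h5 : 0 ≤ t * x ^ 2 := mul_nonneg (by linarith) (by positivity)
  have h6 : 0 ≤ γ * x ^ 2 := by positivity
  nlinarith

/-- quadratic form bound -/
lemma aux_tail {A B : H →L[ℝ] H} {lamhat : ℕ → ℝ} {psihat : ℕ → H}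
    (hpsihat : Orthonormal ℝ psihat) (hnnhat : ∀ k, 0 ≤ lamhat k)
    (hBeig : ∀ i, B (psihat i) = lamhat i • psihat i)
    (hBsymm : ∀ x y, ⟪B x, y⟫_ℝ = ⟪x, B y⟫_ℝ)
    {n K : ℕ} (φ : Fin n → H) (hφ : Orthonormal ℝ φ) (θ : Fin K → ℝ) (g : Fin n → Fin K)
    (hA : ∀ a, A (φ a) = θ (g a) • φ a) (c : ℝ) (J s : Finset ℕ) (hs : Disjoint s J)
    (hc : ∀ j, ∀ l ∉ J, lamhat l ≤ c * (lamhat l - θ j) ^ 2) (hc0 : 0 ≤ c)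
    (v : Fin n → ℝ) :
    ∑ l ∈ s, lamhat l * ⟪psihat l, ∑ a, v a • φ a⟫_ℝ ^ 2
      ≤ K * c * ‖B - A‖ ^ 2 * ∑ a, v a ^ 2 := by
  classical
  set W : Fin K → H := fun j => ∑ a, (if g a = j then v a else 0) • φ a with hW
  have hsumW : ∑ a, v a • φ a = ∑ j, W j := by
    rw [hW, Finset.sum_comm]
    refine Finset.sum_congr rfl fun a _ => ?_
    simp [ite_smul]
  have hAW : ∀ j, A (W j) = θ j • W j := by
    intro j
    simp only [hW, map_sum, map_smul, Finset.smul_sum]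
    refine Finset.sum_congr rfl fun a _ => ?_
    split_ifs with h
    · rw [hA, h, smul_comm]
    · simp
  have hWn : ∑ j, ‖W j‖ ^ 2 = ∑ a, v a ^ 2 := by
    have : ∀ j, ‖W j‖ ^ 2 = ∑ a, if g a = j then v a ^ 2 else 0 := by
      intro j
      rw [← real_inner_self_eq_norm_sq]
      simp only [hW]
      rw [hφ.inner_sum]
      refine Finset.sum_congr rfl fun a _ => ?_
      split_ifs <;> simp [sq]
    simp_rw [this]
    rw [Finset.sum_comm]
    simp
  have hkey : ∀ j l, (lamhat l - θ j) * ⟪psihat l, W j⟫_ℝ = ⟪psihat l, (B - A) (W j)⟫_ℝ := by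
    intro j l
    rw [ContinuousLinearMap.sub_apply, inner_sub_right, hAW, ← hBsymm, hBeig, inner_smul_left,
      inner_smul_right]
    simp [sub_mul]
  have hpt : ∀ l ∈ s, lamhat l * ⟪psihat l, ∑ a, v a • φ a⟫_ℝ ^ 2
      ≤ K * ∑ j, c * ‖⟪psihat l, (B - A) (W j)⟫_ℝ‖ ^ 2 := by
    intro l hl
    have hlJ : l ∉ J := Finset.disjoint_left.1 hs hl
    rw [hsumW, inner_sum]
    have h1 := sq_sum_le_card_mul_sum_sq (s := Finset.univ) (f := fun j => ⟪psihat l, W j⟫_ℝ)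
    rw [Finset.card_univ, Fintype.card_fin] at h1
    refine (mul_le_mul_of_nonneg_left h1 (hnnhat l)).trans ?_
    rw [mul_left_comm, Finset.mul_sum]
    refine mul_le_mul_of_nonneg_left (Finset.sum_le_sum fun j _ => ?_) (Nat.cast_nonneg _)
    rw [← hkey, Real.norm_eq_abs, sq_abs, mul_pow, ← mul_assoc]
    exact mul_le_mul_of_nonneg_right (hc j l hlJ) (sq_nonneg _)
  refine (Finset.sum_le_sum hpt).trans ?_
  rw [← Finset.mul_sum, Finset.sum_comm, mul_assoc, mul_assoc, ← hWn]
  refine mul_le_mul_of_nonneg_left ?_ (Nat.cast_nonneg _)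
  rw [Finset.mul_sum, Finset.mul_sum]
  refine Finset.sum_le_sum fun j _ => ?_
  rw [← Finset.mul_sum]
  refine mul_le_mul_of_nonneg_left ?_ hc0
  refine (hpsihat.sum_inner_products_le _).trans ?_
  rw [← mul_pow]
  exact pow_le_pow_left₀ (norm_nonneg _) ((B - A).le_opNorm _) 2

lemma aux_norm {m : ℕ} (M : Matrix (Fin m) (Fin m) ℝ) (hM : M.IsHermitian) (C : ℝ) (hC : 0 ≤ C)
    (h : ∀ v : Fin m → ℝ, |v ⬝ᵥ M.mulVec v| ≤ C * ∑ a, v a ^ 2) : matOpNorm M ≤ C := by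
  unfold matOpNorm
  have hsymm : (Matrix.toEuclideanCLM (𝕜 := ℝ) M).IsSymmetric := by
    have := Matrix.isSymmetric_toEuclideanLin_iff.2 hM
    exact this
  rw [ContinuousLinearMap.norm_eq_iSup_rayleighQuotient _ hsymm]
  refine Real.iSup_le (fun x => ?_) hC
  rw [ContinuousLinearMap.rayleighQuotient, abs_div, abs_of_nonneg (sq_nonneg ‖x‖)]
  refine div_le_of_le_mul₀ (sq_nonneg _) hC ?_
  have := h x.ofLp
  rw [EuclideanSpace.real_norm_sq_eq]
  rw [← Matrix.inner_toEuclideanCLM] at this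
  rw [ContinuousLinearMap.reApplyInnerSelf_apply, real_inner_comm]
  exact this

end helpers

/-- Lemma (Gram matrix representation): with `Ψ̂_J = (⟨ψ_k, ψ̂_ℓ⟩)_{k,ℓ∈J}`, if
`‖𝓗̂−𝓗‖/γ_J < 1/4` then
`‖Ψ̂_J diag(λ̂_k) Ψ̂_Jᵀ − diag(λ_k) − (⟨(𝓗̂−𝓗)ψ_k,ψ_ℓ⟩)‖_op
  ≤ 4K(γ_J + 2θ_max)(‖𝓗̂−𝓗‖/γ_J)²`. -/
theorem gram_matrix_eigenvalue_expansion
    (H : Type*) [NormedAddCommGroup H] [InnerProductSpace ℝ H] [CompleteSpace H]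
    [TopologicalSpace.SeparableSpace H]
    (A Ahat : H →L[ℝ] H)
    (hAcomp : IsCompactOperator A) (hAhatcomp : IsCompactOperator Ahat)
    (hAsa : IsSelfAdjoint A) (hAhatsa : IsSelfAdjoint Ahat)
    (lam lamhat : ℕ → ℝ) (psi psihat : ℕ → H)
    (hpsi : Orthonormal ℝ psi) (hpsihat : Orthonormal ℝ psihat)
    (hanti : Antitone lam) (hantihat : Antitone lamhat)
    (hnn : ∀ k, 0 ≤ lam k) (hnnhat : ∀ k, 0 ≤ lamhat k)
    (hlim : Tendsto lam atTop (nhds 0)) (hlimhat : Tendsto lamhat atTop (nhds 0))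
    (hsum : HasSum (fun k => lam k • rankOne (psi k) (psi k)) A)
    (hsumhat : HasSum (fun k => lamhat k • rankOne (psihat k) (psihat k)) Ahat)
    (J : Finset ℕ)
    (γ : ℝ) (hγ : γ = sInf {d : ℝ | ∃ k ∈ J, ∃ ℓ, ℓ ∉ J ∧ d = |lam k - lam ℓ|})
    (hγpos : 0 < γ)
    -- the distinct eigenvalues θ_1 > … > θ_K among {λ_k : k ∈ J}
    (K : ℕ) (hKpos : 0 < K) (θ : Fin K → ℝ) (hθanti : StrictAnti θ)
    (hθsurj : ∀ j : Fin K, ∃ k ∈ J, lam k = θ j)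
    (hθall : ∀ k ∈ J, ∃ j : Fin K, lam k = θ j)
    (hcond : ‖Ahat - A‖ / γ < 1 / 4) :
    -- `e` enumerates `J` in increasing order
    ∀ e : Fin J.card ≃o {x // x ∈ J}, e = J.orderIsoOfFin rfl →
    matOpNorm
        ((Matrix.of fun a b => ⟪psi (e a).1, psihat (e b).1⟫_ℝ)
            * Matrix.diagonal (fun a => lamhat (e a).1)
            * (Matrix.of fun a b => ⟪psi (e a).1, psihat (e b).1⟫_ℝ).transpose
          - Matrix.diagonal (fun a => lam (e a).1)
          - Matrix.of fun a b => ⟪(Ahat - A) (psi (e a).1), psi (e b).1⟫_ℝ)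
      ≤ 4 * K * (γ + 2 * θ ⟨0, hKpos⟩) * (‖Ahat - A‖ / γ) ^ 2 := by
  intro e he
  have hgap : ∀ k ∈ J, ∀ l ∉ J, γ ≤ |lam k - lam l| := by
    intro k hk l hl
    rw [hγ]
    refine csInf_le ⟨0, ?_⟩ ⟨k, hk, l, hl, rfl⟩
    rintro d ⟨_, _, _, _, rfl⟩
    exact abs_nonneg _
  have hε : ‖Ahat - A‖ ≤ γ / 4 := by
    rw [div_lt_iff₀ hγpos] at hcond
    linarith
  have hw1 : ∀ k, |lamhat k - lam k| ≤ ‖Ahat - A‖ := by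
    intro k
    have h1 := aux_weyl hpsi hpsihat hanti hantihat hnn hnnhat hsum hsumhat k
    have h2 := aux_weyl hpsihat hpsi hantihat hanti hnnhat hnn hsumhat hsum k
    rw [norm_sub_rev] at h2
    rw [abs_le]
    constructor <;> linarith
  have hsep : ∀ k ∈ J, ∀ l ∉ J, 3 / 4 * γ ≤ |lamhat l - lam k| := by
    intro k hk l hl
    have h1 := hgap k hk l hl
    have h2 := hw1 l
    have h3 := abs_sub_le (lam l) (lamhat l) (lam k)
    rw [abs_sub_comm] at h1
    rw [abs_sub_comm (lam l) (lamhat l)] at h3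
    linarith
  set t := θ ⟨0, hKpos⟩ with ht
  have hθnn : ∀ j, 0 ≤ θ j := by
    intro j
    obtain ⟨k, _, hk⟩ := hθsurj j
    rw [← hk]
    exact hnn k
  have hθle : ∀ j, θ j ≤ t := fun j => hθanti.antitone (Fin.mk_le_of_le_val (Nat.zero_le _))
  have ht0 : 0 ≤ t := hθnn _
  obtain ⟨c, hcdef⟩ : ∃ c, c = 4 * (γ + 2 * t) / γ ^ 2 := ⟨_, rfl⟩
  have hc0 : 0 ≤ c := by rw [hcdef]; positivity
  have hc : ∀ j, ∀ l ∉ J, lamhat l ≤ c * (lamhat l - θ j) ^ 2 := by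
    intro j l hl
    obtain ⟨k, hkJ, hk⟩ := hθsurj j
    refine aux_scalar hγpos (hθle j) (hθnn j) ?_ hcdef
    rw [← hk]
    exact hsep k hkJ l hl
  have hg : ∀ a : Fin J.card, ∃ j, lam (e a).1 = θ j := fun a => hθall _ (e a).2
  choose g hg using hg
  set φ : Fin J.card → H := fun a => psi (e a).1 with hφdef
  have hφ : Orthonormal ℝ φ :=
    hpsi.comp (fun a => (e a).1) (Subtype.val_injective.comp e.injective)
  have hAφ : ∀ a, A (φ a) = θ (g a) • φ a := fun a => by
    rw [← hg a]; exact aux_eig hpsi hsum _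
  have hBsymm : ∀ x y, ⟪Ahat x, y⟫_ℝ = ⟪x, Ahat y⟫_ℝ :=
    ContinuousLinearMap.isSelfAdjoint_iff_isSymmetric.1 hAhatsa
  have hAsymm : ∀ x y, ⟪A x, y⟫_ℝ = ⟪x, A y⟫_ℝ :=
    ContinuousLinearMap.isSelfAdjoint_iff_isSymmetric.1 hAsa
  have hfin : 4 * K * (γ + 2 * t) * (‖Ahat - A‖ / γ) ^ 2 = K * c * ‖Ahat - A‖ ^ 2 := by
    rw [hcdef]; field_simp
  rw [hfin]
  set C := K * c * ‖Ahat - A‖ ^ 2 with hC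
  refine aux_norm _ ?_ C (by positivity) ?_
  · ext a b
    simp only [Matrix.conjTranspose_apply, Matrix.sub_apply, Matrix.mul_apply, Matrix.of_apply,
      Matrix.transpose_apply, Matrix.diagonal_apply, star_trivial]
    congr 1
    · congr 1
      · simp
        refine Finset.sum_congr rfl fun x _ => ?_
        ring
      · by_cases h : a = b
        · subst h; rfl
        · rw [if_neg h, if_neg (Ne.symm h)]
    · rw [ContinuousLinearMap.sub_apply, ContinuousLinearMap.sub_apply, inner_sub_left,
        inner_sub_left, hBsymm, hAsymm, real_inner_comm, real_inner_comm (A _)]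
  · intro v
    set V : H := ∑ a, v a • φ a with hV
    have hquad : v ⬝ᵥ (((Matrix.of fun a b => ⟪psi (e a).1, psihat (e b).1⟫_ℝ)
            * Matrix.diagonal (fun a => lamhat (e a).1)
            * (Matrix.of fun a b => ⟪psi (e a).1, psihat (e b).1⟫_ℝ).transpose
          - Matrix.diagonal (fun a => lam (e a).1)
          - Matrix.of fun a b => ⟪(Ahat - A) (psi (e a).1), psi (e b).1⟫_ℝ).mulVec v)
        = ∑ l ∈ J, lamhat l * ⟪psihat l, V⟫_ℝ ^ 2 - ⟪Ahat V, V⟫_ℝ := by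
      rw [Matrix.sub_mulVec, Matrix.sub_mulVec, dotProduct_sub, dotProduct_sub]
      have e1 : v ⬝ᵥ (((Matrix.of fun a b => ⟪psi (e a).1, psihat (e b).1⟫_ℝ)
            * Matrix.diagonal (fun a => lamhat (e a).1)
            * (Matrix.of fun a b => ⟪psi (e a).1, psihat (e b).1⟫_ℝ).transpose).mulVec v)
          = ∑ l ∈ J, lamhat l * ⟪psihat l, V⟫_ℝ ^ 2 := by
        rw [← Matrix.mulVec_mulVec, ← Matrix.mulVec_mulVec, Matrix.dotProduct_mulVec,
          ← Matrix.mulVec_transpose]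
        have hu : ∀ b, ((Matrix.of fun a b => ⟪psi (e a).1, psihat (e b).1⟫_ℝ).transpose.mulVec v) b
            = ⟪psihat (e b).1, V⟫_ℝ := by
          intro b
          simp only [Matrix.mulVec, dotProduct, Matrix.transpose_apply, Matrix.of_apply, hV,
            inner_sum, inner_smul_right]
          refine Finset.sum_congr rfl fun a _ => ?_
          rw [real_inner_comm, mul_comm]
        rw [← Finset.sum_coe_sort J, ← e.toEquiv.sum_comp]
        simp only [dotProduct, Matrix.mulVec_diagonal, hu]
        refine Finset.sum_congr rfl fun a _ => ?_
        simp only [RelIso.coe_fn_toEquiv]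
        ring
      have e2 : v ⬝ᵥ ((Matrix.diagonal (fun a => lam (e a).1)).mulVec v) = ⟪A V, V⟫_ℝ := by
        have hAV : A V = ∑ a, (θ (g a) * v a) • φ a := by
          rw [hV, map_sum]
          refine Finset.sum_congr rfl fun a _ => ?_
          rw [map_smul, hAφ, smul_smul, mul_comm]
        rw [hAV, hV, hφ.inner_sum]
        simp only [dotProduct, Matrix.mulVec_diagonal, hg, conj_trivial]
        refine Finset.sum_congr rfl fun a _ => ?_
        ring
      have e3 : v ⬝ᵥ ((Matrix.of fun a b => ⟪(Ahat - A) (psi (e a).1), psi (e b).1⟫_ℝ).mulVec v)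
          = ⟪(Ahat - A) V, V⟫_ℝ := by
        rw [hV, map_sum, sum_inner]
        simp only [dotProduct, Matrix.mulVec, Matrix.of_apply, inner_sum, map_smul,
          inner_smul_left, inner_smul_right, Finset.mul_sum, conj_trivial, hφdef]
        refine Finset.sum_congr rfl fun a _ => Finset.sum_congr rfl fun b _ => ?_
        ring
      rw [e1, e2, e3, ContinuousLinearMap.sub_apply, inner_sub_left]
      ring
    rw [hquad]
    have hS : HasSum (fun l => lamhat l * ⟪psihat l, V⟫_ℝ ^ 2) ⟪Ahat V, V⟫_ℝ := by
      have := aux_inner hsumhat V V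
      simpa only [mul_assoc, ← sq] using this
    have hge : ∑ l ∈ J, lamhat l * ⟪psihat l, V⟫_ℝ ^ 2 ≤ ⟪Ahat V, V⟫_ℝ :=
      sum_le_hasSum J (fun l _ => mul_nonneg (hnnhat l) (sq_nonneg _)) hS
    rw [abs_of_nonpos (by linarith)]
    have hle : ⟪Ahat V, V⟫_ℝ ≤ ∑ l ∈ J, lamhat l * ⟪psihat l, V⟫_ℝ ^ 2 + C * ∑ a, v a ^ 2 := by
      refine hasSum_le_of_sum_le hS fun s => ?_
      have h1 := aux_tail hpsihat hnnhat (aux_eig hpsihat hsumhat) hBsymm φ hφ θ g hAφ c J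
        (s \ J) Finset.sdiff_disjoint hc hc0 v
      have h2 : ∑ l ∈ s, lamhat l * ⟪psihat l, V⟫_ℝ ^ 2
          ≤ ∑ l ∈ J ∪ (s \ J), lamhat l * ⟪psihat l, V⟫_ℝ ^ 2 := by
        refine Finset.sum_le_sum_of_subset_of_nonneg ?_
          (fun l _ _ => mul_nonneg (hnnhat l) (sq_nonneg _))
        rw [Finset.union_sdiff_self_eq_union]
        exact Finset.subset_union_right
      rw [Finset.sum_union Finset.disjoint_sdiff] at h2
      linarith
    linarith
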